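/- Let D = (V,E,w) be a vertex-weighted oriented complete bipartite graph: V = V_1 ⊔ V_2 with V_1, V_2 nonempty, E consists of all pairs (x,y) with x ∈ V_1, y ∈ V_2 (every edge directed from V_1 to V_2), and w(x) = 1 for every x ∈ V_1 (the sources). Then reg(I(D)) = (Σ_{x ∈ V} w(x)) − |V| + 2. -/

import Mathlib

open MvPolynomial

noncomputable section

namespace WOG

variable {k : Type} [Field k]

/-- The maximal graded ideal `(x : x ∈ V)` of the polynomial ring. -/
def mIdeal (k V : Type) [Field k] : Ideal (MvPolynomial V k) :=
  Ideal.span (Set.range (X : V → MvPolynomial V k))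

/-- The edge ideal `I(D) = (x * y^{w(y)} : (x,y) ∈ E)` of a vertex-weighted
oriented graph `D = (V, E, w)`. -/
def edgeIdeal (k : Type) [Field k] {V : Type} (E : Set (V × V)) (w : V → ℕ) :
    Ideal (MvPolynomial V k) :=
  Ideal.span {p : MvPolynomial V k | ∃ e ∈ E, p = X e.1 * X e.2 ^ w e.2}

/-- A minimal graded free resolution `⋯ → F₁ → F₀ → I → 0` of an ideal
`I` of the polynomial ring `S = k[x : x ∈ V]`, where `Fᵢ` is the graded free
module with (finite) homogeneous basis `ι i` whose element `a` sits in degree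
`deg i a` (i.e. `Fᵢ = ⊕_a S(- deg i a)`), the maps are graded (degree-preserving)
`S`-linear maps, the complex is exact, and all the matrix entries of the
differentials lie in the maximal graded ideal `𝔪 = (x : x ∈ V)` (minimality). -/
structure MinFreeRes {V : Type} (I : Ideal (MvPolynomial V k)) where
  ι : ℕ → Type
  finite : ∀ i, Finite (ι i)
  deg : ∀ i, ι i → ℕ
  aug : ((ι 0) →₀ MvPolynomial V k) →ₗ[MvPolynomial V k] MvPolynomial V k
  d : ∀ i, ((ι (i + 1)) →₀ MvPolynomial V k) →ₗ[MvPolynomial V k] ((ι i) →₀ MvPolynomial V k)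
  aug_range : LinearMap.range aug = I
  exact_zero : LinearMap.range (d 0) = LinearMap.ker aug
  exact_succ : ∀ i, LinearMap.range (d (i + 1)) = LinearMap.ker (d i)
  aug_homog : ∀ a, (aug (Finsupp.single a 1)).IsHomogeneous (deg 0 a)
  d_homog : ∀ i a b, (d i (Finsupp.single a 1)) b = 0 ∨
      ∃ e, deg (i + 1) a = deg i b + e ∧ ((d i (Finsupp.single a 1)) b).IsHomogeneous e
  minimal : ∀ i a b, (d i (Finsupp.single a 1)) b ∈ mIdeal k V

/-- The graded Betti number `β_{i,j}(I)`, read off from a minimal graded free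
resolution: the number of basis elements of `Fᵢ` of degree `j`. -/
def MinFreeRes.betti {V : Type} {I : Ideal (MvPolynomial V k)} (R : MinFreeRes I)
    (i j : ℕ) : ℕ :=
  Nat.card {a : R.ι i // R.deg i a = j}

/-- The set `{j - i : β_{i,j}(I) ≠ 0}`; its greatest element is the
Castelnuovo–Mumford regularity `reg I`. -/
def MinFreeRes.regSet {V : Type} {I : Ideal (MvPolynomial V k)} (R : MinFreeRes I) :
    Set ℤ :=
  {t : ℤ | ∃ i j : ℕ, R.betti i j ≠ 0 ∧ t = (j : ℤ) - (i : ℤ)}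

/-- The set `{i : β_{i,j}(I) ≠ 0 for some j}`; its greatest element is the
projective dimension `pd I`. -/
def MinFreeRes.pdSet {V : Type} {I : Ideal (MvPolynomial V k)} (R : MinFreeRes I) :
    Set ℕ :=
  {i : ℕ | ∃ j : ℕ, R.betti i j ≠ 0}

/-- The set of lengths of `I`-regular sequences contained in the maximal graded
ideal `𝔪 = (x : x ∈ V)`; its greatest element is `depth I`. -/
def depthSet (k : Type) [Field k] {V : Type} (I : Ideal (MvPolynomial V k)) : Set ℕ :=
  {n : ℕ | ∃ rs : List (MvPolynomial V k), rs.length = n ∧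
    (∀ r ∈ rs, r ∈ mIdeal k V) ∧ RingTheory.Sequence.IsRegular (↥I) rs}

end WOG

namespace WOG

section Graded

variable {k V : Type} [Field k] {α β γ : Type}

/-- `u` is homogeneous of degree `n` in the graded free module with basis degrees `db`. -/
def IsHomogOf (db : β → ℕ) (n : ℕ) (u : β →₀ MvPolynomial V k) : Prop :=
  ∀ b m, coeff m (u b) ≠ 0 → m.degree + db b = n

/-- A linear map of graded free modules that preserves degrees. -/
def IsGraded (da : α → ℕ) (db : β → ℕ)
    (f : (α →₀ MvPolynomial V k) →ₗ[MvPolynomial V k] (β →₀ MvPolynomial V k)) : Prop :=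
  ∀ a, IsHomogOf db (da a) (f (Finsupp.single a 1))

lemma IsHomogOf.add {db : β → ℕ} {n : ℕ} {u v : β →₀ MvPolynomial V k}
    (hu : IsHomogOf db n u) (hv : IsHomogOf db n v) : IsHomogOf db n (u + v) := by
  intro b m h
  by_cases h0 : coeff m (u b) = 0
  · refine hv b m fun h1 => h ?_
    simp [h0, h1]
  · exact hu b m h0

lemma IsHomogOf.neg {db : β → ℕ} {n : ℕ} {u : β →₀ MvPolynomial V k}
    (hu : IsHomogOf db n u) : IsHomogOf db n (-u) := by
  intro b m h
  exact hu b m fun h1 => h (by simp [h1])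

lemma isHomogOf_zero (db : β → ℕ) (n : ℕ) :
    IsHomogOf db n (0 : β →₀ MvPolynomial V k) := by
  intro b m h
  simp at h

lemma map_apply_eq_sum
    (f : (α →₀ MvPolynomial V k) →ₗ[MvPolynomial V k] (β →₀ MvPolynomial V k))
    (u : α →₀ MvPolynomial V k) (b : β) :
    f u b = ∑ a ∈ u.support, u a * f (Finsupp.single a 1) b := by
  conv_lhs => rw [← Finsupp.sum_single u]
  rw [Finsupp.sum, map_sum, Finsupp.finsetSum_apply]
  refine Finset.sum_congr rfl fun a _ => ?_
  have : Finsupp.single a (u a) = u a • Finsupp.single a (1 : MvPolynomial V k) := by simp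
  rw [this, map_smul]
  rfl

lemma IsGraded.map {da : α → ℕ} {db : β → ℕ}
    {f : (α →₀ MvPolynomial V k) →ₗ[MvPolynomial V k] (β →₀ MvPolynomial V k)}
    (hf : IsGraded da db f) {n : ℕ} {u : α →₀ MvPolynomial V k} (hu : IsHomogOf da n u) :
    IsHomogOf db n (f u) := by
  classical
  intro b m h
  rw [map_apply_eq_sum, coeff_sum] at h
  obtain ⟨a, -, ha⟩ := Finset.exists_ne_zero_of_sum_ne_zero h
  rw [coeff_mul] at ha
  obtain ⟨⟨p, q⟩, hpq, h2⟩ := Finset.exists_ne_zero_of_sum_ne_zero ha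
  have hp := hu a p (left_ne_zero_of_mul h2)
  have hq := hf a b q (right_ne_zero_of_mul h2)
  rw [Finset.HasAntidiagonal.mem_antidiagonal] at hpq
  simp only at hpq
  rw [← hpq, map_add]
  omega

/-- The degree `n` part of an element of a graded free module. -/
def homogPart (db : β → ℕ) (n : ℕ) :
    (β →₀ MvPolynomial V k) →+ (β →₀ MvPolynomial V k) :=
  Finsupp.liftAddHom fun b => (Finsupp.singleAddHom b).comp
    (if db b ≤ n then (homogeneousComponent (n - db b)).toAddMonoidHom else 0)

lemma homogPart_single_monomial (db : β → ℕ) (n : ℕ) (b : β) (m : V →₀ ℕ) (c : k) :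
    homogPart db n (Finsupp.single b (monomial m c)) =
      if m.degree + db b = n then Finsupp.single b (monomial m c) else 0 := by
  have key : homogPart db n (Finsupp.single b (monomial m c)) =
    Finsupp.single b ((if db b ≤ n then
      (homogeneousComponent (σ := V) (R := k) (n - db b)).toAddMonoidHom else 0)
        (monomial m c)) := by
    simp [homogPart]
  rw [key]
  have h1 := homogeneousComponent_of_mem (R := k) (m := n - db b)
    (isHomogeneous_monomial c (rfl : m.degree = m.degree))
  by_cases h : m.degree + db b = n
  · rw [if_pos h, if_pos (by omega)]
    simp only [LinearMap.toAddMonoidHom_coe]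
    rw [h1, if_pos (by omega)]
  · rw [if_neg h]
    split_ifs with h2
    · simp only [LinearMap.toAddMonoidHom_coe]
      rw [h1, if_neg (by omega), Finsupp.single_zero]
    · simp

@[elab_as_elim]
lemma finsupp_monomial_induction {p : (β →₀ MvPolynomial V k) → Prop}
    (u : β →₀ MvPolynomial V k)
    (zero : p 0) (add : ∀ u v, p u → p v → p (u + v))
    (single : ∀ b m c, p (Finsupp.single b (monomial m c))) : p u := by
  induction u using Finsupp.induction_linear with
  | zero => exact zero
  | add u v hu hv => exact add u v hu hv
  | single b q =>
    induction q using MvPolynomial.induction_on' with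
    | monomial m c => exact single b m c
    | add q r hq hr => rw [Finsupp.single_add]; exact add _ _ hq hr

lemma isHomogOf_single_monomial (db : β → ℕ) (b : β) (m : V →₀ ℕ) (c : k) :
    IsHomogOf db (m.degree + db b) (Finsupp.single b (monomial m c)) := by
  classical
  intro b' m' h
  rw [Finsupp.single_apply] at h
  split_ifs at h with hb
  · rw [coeff_monomial] at h
    split_ifs at h with hm
    · rw [hb, hm]
    · exact absurd rfl h
  · simp at h

lemma isHomogOf_homogPart (db : β → ℕ) (n : ℕ) (u : β →₀ MvPolynomial V k) :
    IsHomogOf db n (homogPart db n u) := by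
  induction u using finsupp_monomial_induction with
  | zero => rw [map_zero]; exact isHomogOf_zero _ _
  | add u v hu hv => rw [map_add]; exact hu.add hv
  | single b m c =>
    rw [homogPart_single_monomial]
    split_ifs with h
    · rw [← h]; exact isHomogOf_single_monomial db b m c
    · exact isHomogOf_zero _ _

lemma coeff_homogPart (db : β → ℕ) (n : ℕ) (u : β →₀ MvPolynomial V k) (b : β) (m : V →₀ ℕ) :
    coeff m (homogPart db n u b) = if m.degree + db b = n then coeff m (u b) else 0 := by
  classical
  induction u using finsupp_monomial_induction with
  | zero => simp
  | add u v hu hv =>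
    rw [map_add, Finsupp.add_apply, coeff_add, hu, hv]
    split_ifs <;> simp
  | single b' m' c =>
    rw [homogPart_single_monomial]
    by_cases hb : b' = b
    · subst hb
      by_cases hm : m' = m
      · subst hm
        split_ifs <;> simp
      · split_ifs <;> simp [coeff_monomial, hm]
    · split_ifs <;> simp [hb]

lemma IsHomogOf.homogPart_eq {db : β → ℕ} {n : ℕ} {u : β →₀ MvPolynomial V k}
    (hu : IsHomogOf db n u) : homogPart db n u = u := by
  ext b m
  rw [coeff_homogPart]
  split_ifs with h
  · rfl
  · by_contra h0
    exact h (hu b m (Ne.symm h0))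

lemma IsHomogOf.homogPart_eq_zero {db : β → ℕ} {n n' : ℕ} {u : β →₀ MvPolynomial V k}
    (hu : IsHomogOf db n u) (h : n ≠ n') : homogPart db n' u = 0 := by
  ext b m
  rw [coeff_homogPart]
  split_ifs with h'
  · by_contra h0
    exact h ((hu b m (by simpa using h0)).symm.trans h')
  · simp

lemma IsGraded.homogPart_map {da : α → ℕ} {db : β → ℕ}
    {f : (α →₀ MvPolynomial V k) →ₗ[MvPolynomial V k] (β →₀ MvPolynomial V k)}
    (hf : IsGraded da db f) (n : ℕ) (u : α →₀ MvPolynomial V k) :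
    homogPart db n (f u) = f (homogPart da n u) := by
  induction u using finsupp_monomial_induction with
  | zero => simp
  | add u v hu hv => simp only [map_add, hu, hv]
  | single a m c =>
    have h1 := isHomogOf_single_monomial da a m c
    by_cases h : m.degree + da a = n
    · subst h
      rw [h1.homogPart_eq, (hf.map h1).homogPart_eq]
    · rw [h1.homogPart_eq_zero h, (hf.map h1).homogPart_eq_zero h, map_zero]

/-- A graded map into the image of a graded map `d` factors through `d` by a graded map. -/
lemma IsGraded.exists_factor {da : α → ℕ} {db : β → ℕ} {dc : γ → ℕ}
    {d : (β →₀ MvPolynomial V k) →ₗ[MvPolynomial V k] (γ →₀ MvPolynomial V k)}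
    (hd : IsGraded db dc d)
    {u : (α →₀ MvPolynomial V k) →ₗ[MvPolynomial V k] (γ →₀ MvPolynomial V k)}
    (hu : IsGraded da dc u) (h : ∀ x, ∃ y, d y = u x) :
    ∃ v : (α →₀ MvPolynomial V k) →ₗ[MvPolynomial V k] (β →₀ MvPolynomial V k),
      IsGraded da db v ∧ ∀ x, d (v x) = u x := by
  have h' : ∀ a, ∃ y, IsHomogOf db (da a) y ∧ d y = u (Finsupp.single a 1) := by
    intro a
    obtain ⟨y, hy⟩ := h (Finsupp.single a 1)
    refine ⟨homogPart db (da a) y, isHomogOf_homogPart _ _ _, ?_⟩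
    rw [← hd.homogPart_map, hy, (hu a).homogPart_eq]
  choose y hy hdy using h'
  have hv : ∀ a, Finsupp.linearCombination (MvPolynomial V k) y (Finsupp.single a 1) = y a := by
    intro a
    simp
  refine ⟨Finsupp.linearCombination (MvPolynomial V k) y, fun a => ?_, fun x => ?_⟩
  · rw [hv]; exact hy a
  · have : d ∘ₗ Finsupp.linearCombination (MvPolynomial V k) y = u := by
      apply Finsupp.lhom_ext'
      intro a
      ext1
      simp [hdy]
    exact LinearMap.congr_fun this x

end Graded

/-- A graded free resolution, not necessarily minimal, of the quotient ring by `I`. -/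
structure GrRes {k V : Type} [Field k] (I : Ideal (MvPolynomial V k)) where
  ι : ℕ → Type
  deg : ∀ i, ι i → ℕ
  d : ∀ i, (ι (i + 1) →₀ MvPolynomial V k) →ₗ[MvPolynomial V k] (ι i →₀ MvPolynomial V k)
  graded : ∀ i, IsGraded (deg (i + 1)) (deg i) (d i)
  root : Unique (ι 0)
  deg_root : deg 0 root.default = 0
  exact : ∀ i u, d i u = 0 ↔ ∃ v, d (i + 1) v = u
  range_zero : ∀ u, (∃ v, d 0 v = u) ↔ u root.default ∈ I

namespace GrRes

variable {k V : Type} [Field k] {I J : Ideal (MvPolynomial V k)}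

lemma d_d (F : GrRes I) (i : ℕ) (v) : F.d i (F.d (i + 1) v) = 0 :=
  (F.exact i _).2 ⟨v, rfl⟩

/-- Multiplication by a form `m` with `m I ⊆ J` lifts to a graded map of resolutions. -/
lemma exists_lift (F : GrRes I) (G : GrRes J) {m : MvPolynomial V k} {e : ℕ}
    (hm : m.IsHomogeneous e) (h : ∀ p ∈ I, m * p ∈ J) :
    ∃ f : ∀ i, (F.ι i →₀ MvPolynomial V k) →ₗ[MvPolynomial V k] (G.ι i →₀ MvPolynomial V k),
      (∀ i, IsGraded (fun a => F.deg i a + e) (G.deg i) (f i)) ∧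
      (∀ i u, G.d i (f (i + 1) u) = f i (F.d i u)) ∧
      ∀ u, f 0 u G.root.default = m * u F.root.default := by
  have hFgr : ∀ i, IsGraded (fun a => F.deg (i + 1) a + e) (fun a => F.deg i a + e) (F.d i) := by
    intro i a b n hn
    have := F.graded i a b n hn
    simp only
    omega
  have hcomp : ∀ {i} {f : (F.ι i →₀ MvPolynomial V k) →ₗ[MvPolynomial V k]
      (G.ι i →₀ MvPolynomial V k)}, IsGraded (fun a => F.deg i a + e) (G.deg i) f →
      IsGraded (fun a => F.deg (i + 1) a + e) (G.deg i) (f ∘ₗ F.d i) :=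
    fun hf a => hf.map (hFgr _ a)
  let f0 : (F.ι 0 →₀ MvPolynomial V k) →ₗ[MvPolynomial V k] (G.ι 0 →₀ MvPolynomial V k) :=
    Finsupp.lsingle G.root.default ∘ₗ LinearMap.mulLeft (MvPolynomial V k) m ∘ₗ
      Finsupp.lapply F.root.default
  have hf0 : ∀ u, f0 u G.root.default = m * u F.root.default := by
    intro u
    simp [f0]
  have hf0gr : IsGraded (fun a => F.deg 0 a + e) (G.deg 0) f0 := by
    intro a b n hn
    have ha : a = F.root.default := F.root.uniq a
    have hb : b = G.root.default := G.root.uniq b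
    subst ha hb
    rw [hf0, Finsupp.single_eq_same, mul_one] at hn
    have h1 : n.degree = e := by
      rw [Finsupp.degree_eq_weight_one]
      exact hm hn
    simp only [F.deg_root, G.deg_root]
    omega
  obtain ⟨f1, hf1, hf1'⟩ := (G.graded 0).exists_factor (hcomp hf0gr) (by
    intro x
    rw [G.range_zero]
    simp only [LinearMap.comp_apply]
    rw [hf0]
    exact h _ ((F.range_zero _).1 ⟨x, rfl⟩))
  let T : ℕ → Type := fun i =>
    {p : ((F.ι i →₀ MvPolynomial V k) →ₗ[MvPolynomial V k] (G.ι i →₀ MvPolynomial V k)) ×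
      ((F.ι (i + 1) →₀ MvPolynomial V k) →ₗ[MvPolynomial V k]
        (G.ι (i + 1) →₀ MvPolynomial V k)) //
      IsGraded (fun a => F.deg i a + e) (G.deg i) p.1 ∧
      IsGraded (fun a => F.deg (i + 1) a + e) (G.deg (i + 1)) p.2 ∧
      ∀ u, G.d i (p.2 u) = p.1 (F.d i u)}
  have step : ∀ i (p : T i), ∃ q : T (i + 1), q.1.1 = p.1.2 := by
    rintro i ⟨⟨p, q⟩, hp, hq, hpq⟩
    obtain ⟨r, hr, hr'⟩ := (G.graded (i + 1)).exists_factor (hcomp hq) (by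
      intro x
      rw [← G.exact]
      simp only [LinearMap.comp_apply]
      rw [hpq, F.d_d, map_zero])
    exact ⟨⟨⟨q, r⟩, hq, hr, hr'⟩, rfl⟩
  choose nxt hnxt using step
  let s : ∀ i, T i := fun i => Nat.rec ⟨⟨f0, f1⟩, hf0gr, hf1, hf1'⟩ nxt i
  refine ⟨fun i => (s i).1.1, fun i => (s i).2.1, fun i u => ?_, hf0⟩
  have : (s (i + 1)).1.1 = (s i).1.2 := hnxt i (s i)
  simp only [this]
  exact (s i).2.2.2 u

/-- A chain endomorphism vanishing in homological degree `0` is null-homotopic. -/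
lemma exists_homotopy (F : GrRes I)
    (φ : ∀ i, (F.ι i →₀ MvPolynomial V k) →ₗ[MvPolynomial V k] (F.ι i →₀ MvPolynomial V k))
    (hφ : ∀ i u, F.d i (φ (i + 1) u) = φ i (F.d i u)) (h0 : φ 0 = 0) :
    ∃ h : ∀ i, (F.ι i →₀ MvPolynomial V k) →ₗ[MvPolynomial V k]
        (F.ι (i + 1) →₀ MvPolynomial V k),
      ∀ i u, φ (i + 1) u = F.d (i + 1) (h (i + 1) u) + h i (F.d i u) := by
  let T : ℕ → Type := fun i =>
    {h : (F.ι i →₀ MvPolynomial V k) →ₗ[MvPolynomial V k] (F.ι (i + 1) →₀ MvPolynomial V k) //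
      ∀ u, F.d i (φ (i + 1) u) = F.d i (h (F.d i u))}
  have step : ∀ i (p : T i), ∃ q : T (i + 1), ∀ u,
      φ (i + 1) u = F.d (i + 1) (q.1 u) + p.1 (F.d i u) := by
    rintro i ⟨p, hp⟩
    have h1 : ∀ a, ∃ y, F.d (i + 1) y =
        (φ (i + 1) - p ∘ₗ F.d i) (Finsupp.single a 1) := by
      intro a
      rw [← F.exact]
      simp [hp]
    choose y hy using h1
    have h2 : F.d (i + 1) ∘ₗ Finsupp.linearCombination (MvPolynomial V k) y =
        φ (i + 1) - p ∘ₗ F.d i := by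
      apply Finsupp.lhom_ext'
      intro a
      ext1
      simp [hy]
    have h3 : ∀ u, φ (i + 1) u =
        F.d (i + 1) (Finsupp.linearCombination (MvPolynomial V k) y u) + p (F.d i u) := by
      intro u
      have := LinearMap.congr_fun h2 u
      simp only [LinearMap.comp_apply, LinearMap.sub_apply] at this
      rw [this, sub_add_cancel]
    refine ⟨⟨Finsupp.linearCombination (MvPolynomial V k) y, fun u => ?_⟩, h3⟩
    rw [hφ, h3, F.d_d, map_zero, add_zero]
  choose nxt hnxt using step
  let s : ∀ i, T i := fun i => Nat.rec ⟨0, fun u => by simp [hφ, h0]⟩ nxt i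
  exact ⟨fun i => (s i).1, fun i u => hnxt i (s i) u⟩

/-- A basis element of a resolution of `S / I` all of whose incident matrix entries are non-units
has the degree of some basis element, in the same homological degree, of any other resolution. -/
lemma exists_deg_eq (F G : GrRes I) (i : ℕ) (a : F.ι (i + 1))
    (h₁ : ∀ c, constantCoeff (F.d (i + 1) (Finsupp.single c 1) a) = 0)
    (h₂ : ∀ c, constantCoeff (F.d i (Finsupp.single a 1) c) = 0) :
    ∃ b, G.deg (i + 1) b = F.deg (i + 1) a := by
  have one_mul_mem : ∀ p ∈ I, 1 * p ∈ I := by simp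
  obtain ⟨f, hf, hfd, hf0⟩ := F.exists_lift G (isHomogeneous_one V k) one_mul_mem
  obtain ⟨g, -, hgd, hg0⟩ := G.exists_lift F (isHomogeneous_one V k) one_mul_mem
  obtain ⟨h, hh⟩ := F.exists_homotopy (fun i => g i ∘ₗ f i - LinearMap.id)
    (by intro i u; simp [hfd, hgd]) (by
      refine LinearMap.ext fun u => Finsupp.ext fun x => ?_
      have hx : x = F.root.default := F.root.uniq x
      subst hx
      simp [hg0, hf0])
  have key := congrArg (fun v => constantCoeff (v a)) (hh i (Finsupp.single a 1))
  simp only [LinearMap.sub_apply, LinearMap.comp_apply, LinearMap.id_apply, Finsupp.sub_apply,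
    Finsupp.add_apply, Finsupp.single_eq_same, map_sub, map_add, map_one] at key
  rw [map_apply_eq_sum (F.d (i + 1)), map_apply_eq_sum (h i), map_sum, map_sum,
    Finset.sum_eq_zero (fun c _ => by rw [map_mul, h₁, mul_zero]),
    Finset.sum_eq_zero (fun c _ => by rw [map_mul, h₂, zero_mul]), add_zero, sub_eq_zero,
    map_apply_eq_sum, map_sum] at key
  obtain ⟨b, -, hb⟩ := Finset.exists_ne_zero_of_sum_ne_zero (key.trans_ne one_ne_zero)
  rw [map_mul] at hb
  have := hf (i + 1) a b 0 (left_ne_zero_of_mul hb)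
  exact ⟨b, by simpa using this⟩

end GrRes

section Cone

variable {k V : Type} [Field k] {I J : Ideal (MvPolynomial V k)}

/-- The basis of the mapping cone of a map from a resolution `F` to a resolution `G`. -/
def coneIndex (F : GrRes I) (G : GrRes J) : ℕ → Type
  | 0 => G.ι 0
  | i + 1 => G.ι (i + 1) ⊕ F.ι i

/-- The degrees of the basis of a mapping cone, with the source shifted by `e`. -/
def coneDeg (F : GrRes I) (G : GrRes J) (e : ℕ) : ∀ i, coneIndex F G i → ℕ
  | 0 => G.deg 0
  | i + 1 => Sum.elim (G.deg (i + 1)) (fun b => F.deg i b + e)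

/-- The bottom term of a mapping cone. -/
def coneRoot (F : GrRes I) (G : GrRes J) :
    (coneIndex F G 0 →₀ MvPolynomial V k) ≃ₗ[MvPolynomial V k] (G.ι 0 →₀ MvPolynomial V k) :=
  LinearEquiv.refl _ (G.ι 0 →₀ MvPolynomial V k)

/-- The higher terms of a mapping cone. -/
def coneEquiv (F : GrRes I) (G : GrRes J) (i : ℕ) :
    (coneIndex F G (i + 1) →₀ MvPolynomial V k) ≃ₗ[MvPolynomial V k]
      (G.ι (i + 1) →₀ MvPolynomial V k) × (F.ι i →₀ MvPolynomial V k) :=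
  Finsupp.sumFinsuppLEquivProdFinsupp (α := G.ι (i + 1)) (β := F.ι i) (MvPolynomial V k)

lemma isHomogOf_coneRoot {F : GrRes I} {G : GrRes J} (e : ℕ) {n : ℕ}
    {u : G.ι 0 →₀ MvPolynomial V k} (hu : IsHomogOf (G.deg 0) n u) :
    IsHomogOf (coneDeg F G e 0) n ((coneRoot F G).symm u) := hu

lemma isHomogOf_coneEquiv {F : GrRes I} {G : GrRes J} {e i n : ℕ}
    {u : G.ι (i + 1) →₀ MvPolynomial V k} {v : F.ι i →₀ MvPolynomial V k}
    (hu : IsHomogOf (G.deg (i + 1)) n u) (hv : IsHomogOf (fun b => F.deg i b + e) n v) :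
    IsHomogOf (coneDeg F G e (i + 1)) n ((coneEquiv F G i).symm (u, v)) := by
  rintro (a | b) m h
  · exact hu a m h
  · exact hv b m h

lemma coneIndex_cases (F : GrRes I) (G : GrRes J) (e i : ℕ) (x : coneIndex F G (i + 1)) :
    (∃ a, coneDeg F G e (i + 1) x = G.deg (i + 1) a ∧
      Finsupp.single x 1 = (coneEquiv F G i).symm (Finsupp.single a 1, 0)) ∨
    ∃ b, coneDeg F G e (i + 1) x = F.deg i b + e ∧
      Finsupp.single x 1 = (coneEquiv F G i).symm (0, Finsupp.single b 1) := by
  classical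
  rcases x with a | b
  · refine Or.inl ⟨a, rfl, ?_⟩
    rw [LinearEquiv.eq_symm_apply]
    change Finsupp.sumFinsuppLEquivProdFinsupp (MvPolynomial V k)
      (Finsupp.single (Sum.inl a : G.ι (i + 1) ⊕ F.ι i) 1) = _
    ext x : 2 <;> simp [Finsupp.single_apply]
  · refine Or.inr ⟨b, rfl, ?_⟩
    rw [LinearEquiv.eq_symm_apply]
    change Finsupp.sumFinsuppLEquivProdFinsupp (MvPolynomial V k)
      (Finsupp.single (Sum.inr b : G.ι (i + 1) ⊕ F.ι i) 1) = _
    ext x : 2 <;> simp [Finsupp.single_apply]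

/-- The differential of a mapping cone. -/
def coneD (F : GrRes I) (G : GrRes J)
    (f : ∀ i, (F.ι i →₀ MvPolynomial V k) →ₗ[MvPolynomial V k] (G.ι i →₀ MvPolynomial V k)) :
    ∀ i, (coneIndex F G (i + 1) →₀ MvPolynomial V k) →ₗ[MvPolynomial V k]
      (coneIndex F G i →₀ MvPolynomial V k)
  | 0 => (coneRoot F G).symm.toLinearMap ∘ₗ (G.d 0).coprod (f 0) ∘ₗ (coneEquiv F G 0).toLinearMap
  | i + 1 => (coneEquiv F G i).symm.toLinearMap ∘ₗ
      ((G.d (i + 1)).coprod (f (i + 1))).prod (-(F.d i ∘ₗ LinearMap.snd _ _ _)) ∘ₗ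
      (coneEquiv F G (i + 1)).toLinearMap

lemma coneD_zero (F : GrRes I) (G : GrRes J)
    (f : ∀ i, (F.ι i →₀ MvPolynomial V k) →ₗ[MvPolynomial V k] (G.ι i →₀ MvPolynomial V k))
    (p q) :
    coneD F G f 0 ((coneEquiv F G 0).symm (p, q)) =
      (coneRoot F G).symm (G.d 0 p + f 0 q) := by
  simp [coneD]

lemma coneD_succ (F : GrRes I) (G : GrRes J)
    (f : ∀ i, (F.ι i →₀ MvPolynomial V k) →ₗ[MvPolynomial V k] (G.ι i →₀ MvPolynomial V k))
    (i : ℕ) (p q) :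
    coneD F G f (i + 1) ((coneEquiv F G (i + 1)).symm (p, q)) =
      (coneEquiv F G i).symm (G.d (i + 1) p + f (i + 1) q, -F.d i q) := by
  simp [coneD]

lemma coneD_graded (F : GrRes I) (G : GrRes J) {e : ℕ}
    {f : ∀ i, (F.ι i →₀ MvPolynomial V k) →ₗ[MvPolynomial V k] (G.ι i →₀ MvPolynomial V k)}
    (hf : ∀ i, IsGraded (fun a => F.deg i a + e) (G.deg i) (f i)) (i : ℕ) :
    IsGraded (coneDeg F G e (i + 1)) (coneDeg F G e i) (coneD F G f i) := by
  intro x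
  rcases coneIndex_cases F G e i x with ⟨a, ha, hx⟩ | ⟨b, hb, hx⟩
  · rw [hx, ha]
    cases i with
    | zero =>
      rw [coneD_zero, map_zero, add_zero]
      exact isHomogOf_coneRoot e (G.graded 0 a)
    | succ i =>
      rw [coneD_succ, map_zero, map_zero, add_zero, neg_zero]
      exact isHomogOf_coneEquiv (G.graded _ a) (isHomogOf_zero _ _)
  · rw [hx, hb]
    cases i with
    | zero =>
      rw [coneD_zero, map_zero, zero_add]
      exact isHomogOf_coneRoot e (hf 0 b)
    | succ i =>
      rw [coneD_succ, map_zero, zero_add]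
      refine isHomogOf_coneEquiv (hf _ b) (IsHomogOf.neg fun c n hn => ?_)
      have := F.graded i b c n hn
      omega

/-- If `I = J : m`, the mapping cone of a lift of multiplication by `m` resolves the quotient
by `J + (m)`. -/
lemma exists_cone (F : GrRes I) (G : GrRes J) {m : MvPolynomial V k} {e : ℕ}
    (hm : m.IsHomogeneous e) (h : ∀ p, p ∈ I ↔ m * p ∈ J) :
    ∃ H : GrRes (J ⊔ Ideal.span {m}),
      (∀ i (x : H.ι (i + 1)), (∃ a, H.deg _ x = G.deg (i + 1) a) ∨
        ∃ b, H.deg _ x = F.deg i b + e) ∧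
      ∀ i (b : F.ι i), ∃ x, H.deg (i + 1) x = F.deg i b + e := by
  obtain ⟨f, hf, hfd, hf0⟩ := F.exists_lift G hm fun p hp => (h p).1 hp
  have hsurj : ∀ {i} (u : coneIndex F G (i + 1) →₀ MvPolynomial V k), ∃ p q,
      u = (coneEquiv F G i).symm (p, q) := fun {i} u =>
    ⟨_, _, ((coneEquiv F G i).symm_apply_apply u).symm⟩
  have hexact : ∀ i q, (∃ q', F.d i q' = q) → ∀ p, G.d i p + f i q = 0 →
      ∃ p' q', G.d (i + 1) p' + f (i + 1) q' = p ∧ -F.d i q' = q := by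
    rintro i q ⟨q', rfl⟩ p hp
    rw [← hfd, ← map_add] at hp
    obtain ⟨p', hp'⟩ := (G.exact _ _).1 hp
    exact ⟨p', -q', by simp [hp'], by simp⟩
  refine ⟨{ ι := coneIndex F G
            deg := coneDeg F G e
            d := coneD F G f
            graded := coneD_graded F G hf
            root := G.root
            deg_root := G.deg_root
            exact := ?_
            range_zero := ?_ }, ?_, ?_⟩
  · intro i u
    obtain ⟨p, q, rfl⟩ := hsurj u
    constructor
    · intro hu
      have key : (∃ q', F.d i q' = q) ∧ G.d i p + f i q = 0 := by
        cases i with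
        | zero =>
          rw [coneD_zero, LinearEquiv.map_eq_zero_iff] at hu
          refine ⟨(F.range_zero q).2 ((h _).2 ?_), hu⟩
          rw [← hf0, ← neg_mem_iff, ← Finsupp.neg_apply, ← G.range_zero]
          exact ⟨p, eq_neg_of_add_eq_zero_left hu⟩
        | succ i =>
          rw [coneD_succ, LinearEquiv.map_eq_zero_iff, Prod.mk_eq_zero, neg_eq_zero] at hu
          exact ⟨(F.exact i q).1 hu.2, hu.1⟩
      obtain ⟨p', q', hp, hq⟩ := hexact i q key.1 p key.2
      refine ⟨(coneEquiv F G (i + 1)).symm (p', q'), ?_⟩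
      rw [coneD_succ, hp, hq]
    · rintro ⟨v, hv⟩
      obtain ⟨p', q', rfl⟩ := hsurj v
      rw [coneD_succ] at hv
      rw [← hv]
      cases i with
      | zero => simp [coneD_zero, G.d_d, hfd]
      | succ i => simp [coneD_succ, G.d_d, F.d_d, hfd]
  · intro u
    obtain ⟨u, rfl⟩ := (coneRoot F G).symm.surjective u
    change _ ↔ u G.root.default ∈ _
    constructor
    · rintro ⟨v, hv⟩
      obtain ⟨p, q, rfl⟩ := hsurj v
      rw [coneD_zero, EmbeddingLike.apply_eq_iff_eq] at hv
      rw [← hv]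
      refine Submodule.add_mem_sup ((G.range_zero _).1 ⟨p, rfl⟩) ?_
      rw [hf0]
      exact Ideal.mul_mem_right _ _ (Ideal.mem_span_singleton_self m)
    · intro hu
      obtain ⟨y, hy, z, hz, hyz⟩ := Submodule.mem_sup.1 hu
      obtain ⟨c, rfl⟩ := Ideal.mem_span_singleton'.1 hz
      obtain ⟨p, hp⟩ := (G.range_zero (Finsupp.single G.root.default y)).2 (by simpa using hy)
      refine ⟨(coneEquiv F G 0).symm (p, Finsupp.single F.root.default c), ?_⟩
      rw [coneD_zero, hp, EmbeddingLike.apply_eq_iff_eq]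
      refine Finsupp.ext fun x => ?_
      have hx : x = G.root.default := G.root.uniq x
      subst hx
      rw [← hyz]
      simp [hf0, mul_comm]
  · rintro i (a | b)
    · exact Or.inl ⟨a, rfl⟩
    · exact Or.inr ⟨b, rfl⟩
  · intro i b
    exact ⟨Sum.inr b, rfl⟩

end Cone

section Monomial

variable {k V : Type} [Field k]

/-- The ideal generated by the monomials with exponents in `s`. -/
def monIdeal (k : Type) {V : Type} [Field k] (s : Set (V →₀ ℕ)) : Ideal (MvPolynomial V k) :=
  Ideal.span ((fun e => monomial e 1) '' s)

lemma mem_monIdeal_iff_monomial_mul_mem {s t : Set (V →₀ ℕ)} {m : V →₀ ℕ}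
    (h : ∀ e, (∃ a ∈ t, a ≤ e) ↔ ∃ a ∈ s, a ≤ e + m) (p : MvPolynomial V k) :
    p ∈ monIdeal k t ↔ monomial m 1 * p ∈ monIdeal k s := by
  rw [monIdeal, monIdeal, mem_ideal_span_monomial_image, mem_ideal_span_monomial_image]
  constructor
  · intro hp e he
    rw [mem_support_iff, coeff_monomial_mul'] at he
    split_ifs at he with hme
    · rw [one_mul] at he
      have := (h _).1 (hp _ (mem_support_iff.2 he))
      rwa [tsub_add_cancel_of_le hme] at this
    · exact absurd rfl he
  · intro hp e he
    refine (h e).2 (hp _ ?_)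
    rw [mem_support_iff] at he ⊢
    rwa [add_comm e m, coeff_monomial_mul, one_mul]

lemma monIdeal_insert (s : Set (V →₀ ℕ)) (m : V →₀ ℕ) :
    monIdeal k (insert m s) = monIdeal k s ⊔ Ideal.span {monomial m 1} := by
  rw [monIdeal, Set.image_insert_eq, Ideal.span_insert, sup_comm]
  rfl

lemma exists_grRes_insert {s t : Set (V →₀ ℕ)} {m : V →₀ ℕ}
    (h : ∀ e, (∃ a ∈ t, a ≤ e) ↔ ∃ a ∈ s, a ≤ e + m)
    (F : GrRes (monIdeal k t)) (G : GrRes (monIdeal k s)) :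
    ∃ H : GrRes (monIdeal k (insert m s)),
      (∀ i (x : H.ι (i + 1)), (∃ a, H.deg _ x = G.deg (i + 1) a) ∨
        ∃ b, H.deg _ x = F.deg i b + m.degree) ∧
      ∀ i (b : F.ι i), ∃ x, H.deg (i + 1) x = F.deg i b + m.degree := by
  rw [monIdeal_insert]
  exact exists_cone F G (isHomogeneous_monomial 1 rfl) (mem_monIdeal_iff_monomial_mul_mem h)

lemma exists_grRes_empty : ∃ H : GrRes (monIdeal k (∅ : Set (V →₀ ℕ))),
    (∀ i, IsEmpty (H.ι (i + 1))) ∧ (∀ x, H.deg 0 x = 0) := by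
  let κ : ℕ → Type := fun i => Nat.rec Unit (fun _ _ => Empty) i
  have hκ : ∀ i, IsEmpty (κ (i + 1)) := fun i => inferInstanceAs (IsEmpty Empty)
  refine ⟨{ ι := κ
            deg := fun _ _ => 0
            d := fun _ => 0
            graded := fun i a => isEmptyElim a
            root := inferInstanceAs (Unique Unit)
            deg_root := rfl
            exact := fun i u => ⟨fun _ => ⟨0, Subsingleton.elim _ _⟩, fun _ => rfl⟩
            range_zero := fun u => ⟨?_, fun h => ⟨0, ?_⟩⟩ }, hκ, fun _ => rfl⟩
  · rintro ⟨v, rfl⟩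
    simp
  · simp only [monIdeal, Set.image_empty, Ideal.span_empty, Ideal.mem_bot] at h
    refine Finsupp.ext fun x => ?_
    exact h.symm

/-- Koszul-type resolution of the quotient by the powers `v ^ w v`, for `v ∈ T`. -/
lemma exists_grRes_powers {w : V → ℕ} (hw : ∀ v, 1 ≤ w v) (T : Finset V) :
    ∃ H : GrRes (monIdeal k ((fun v => Finsupp.single v (w v)) '' (T : Set V))),
      (∀ i (x : H.ι i), H.deg i x + T.card ≤ ∑ v ∈ T, w v + i ∧ i ≤ T.card) ∧
      ∃ x, H.deg T.card x = ∑ v ∈ T, w v := by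
  classical
  induction T using Finset.induction_on with
  | empty =>
    obtain ⟨H, h1, h2⟩ := exists_grRes_empty (k := k) (V := V)
    rw [Finset.coe_empty, Set.image_empty]
    refine ⟨H, ?_, H.root.default, h2 _⟩
    rintro (_ | i) x
    · simp [h2]
    · exact ((h1 i).false x).elim
  | insert a T ha ih =>
    obtain ⟨G, hG, x, hx⟩ := ih
    have hcolon : ∀ e, (∃ b ∈ (fun v => Finsupp.single v (w v)) '' (T : Set V), b ≤ e) ↔
        ∃ b ∈ (fun v => Finsupp.single v (w v)) '' (T : Set V),
          b ≤ e + Finsupp.single a (w a) := by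
      intro e
      simp only [Set.exists_mem_image]
      refine exists_congr fun v => and_congr_right fun hv => ?_
      have hva : v ≠ a := by rintro rfl; exact ha hv
      rw [Finsupp.single_le_iff, Finsupp.single_le_iff]
      simp [hva]
    obtain ⟨H, hH, hH'⟩ := exists_grRes_insert hcolon G G
    rw [Finset.coe_insert, Set.image_insert_eq]
    refine ⟨H, ?_, ?_⟩
    · rw [Finset.card_insert_of_notMem ha, Finset.sum_insert ha]
      rintro (_ | i) y
      · have h0 := hG 0 G.root.default
        have hy : y = H.root.default := H.root.uniq y
        rw [G.deg_root] at h0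
        rw [hy, H.deg_root]
        have := hw a
        omega
      · rcases hH i y with ⟨b, hb⟩ | ⟨b, hb⟩
        · have := hG _ b
          have := hw a
          rw [hb]
          omega
        · have := hG _ b
          rw [hb, Finsupp.degree_single]
          omega
    · obtain ⟨y, hy⟩ := hH' _ x
      rw [Finset.card_insert_of_notMem ha, Finset.sum_insert ha]
      exact ⟨y, by rw [hy, hx, Finsupp.degree_single, add_comm]⟩

end Monomial

variable {k V : Type} [Field k]

section Bipartite

/-- The exponents of the generators `x * y ^ w y`, for `(x, y) ∈ P`. -/
def edgeExps (w : V → ℕ) (P : Set (V × V)) : Set (V →₀ ℕ) :=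
  (fun p => Finsupp.single p.1 1 + Finsupp.single p.2 (w p.2)) '' P

lemma edgeIdeal_eq_monIdeal (E : Set (V × V)) (w : V → ℕ) :
    edgeIdeal k E w = monIdeal k (edgeExps w E) := by
  have h : ∀ e : V × V, (X e.1 * X e.2 ^ w e.2 : MvPolynomial V k) =
      monomial (Finsupp.single e.1 1 + Finsupp.single e.2 (w e.2)) 1 := by
    intro e
    rw [X_pow_eq_monomial, X, monomial_mul, one_mul]
  rw [edgeIdeal, monIdeal, edgeExps, Set.image_image]
  congr 1
  ext p
  simp only [Set.mem_ofPred_eq, Set.mem_image, h, eq_comm]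

variable [DecidableEq V] {w : V → ℕ} {X Y A B : Finset V} {a b : V}

/-- For a bipartite graph with parts `X`, `Y`, the colon ideal of the edges `A × Y ∪ {a} × B` by
the edge `(a, b)` is generated by powers of the vertices in `A ∪ B`. -/
lemma edgeExps_colon (hw1 : ∀ x ∈ X, w x = 1) (hXY : Disjoint X Y) (hA : A ⊆ X) (hB : B ⊆ Y)
    (ha : a ∈ X) (haA : a ∉ A) (hb : b ∈ Y) (hbB : b ∉ B) (e : V →₀ ℕ) :
    (∃ u ∈ (fun v => Finsupp.single v (w v)) '' ((A ∪ B : Finset V) : Set V), u ≤ e) ↔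
      ∃ u ∈ edgeExps w ((A ×ˢ Y ∪ {a} ×ˢ B : Finset (V × V)) : Set (V × V)),
        u ≤ e + (Finsupp.single a 1 + Finsupp.single b (w b)) := by
  have hne : ∀ {x y}, x ∈ X → y ∈ Y → x ≠ y := by
    rintro x y hx hy rfl
    exact Finset.disjoint_left.1 hXY hx hy
  simp only [edgeExps, Set.exists_mem_image]
  constructor
  · rintro ⟨v, hv, hve⟩
    rcases Finset.mem_union.1 (Finset.mem_coe.1 hv) with hvA | hvB
    · refine ⟨(v, b), by simp [hvA, hb], ?_⟩
      rw [hw1 v (hA hvA)] at hve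
      exact add_le_add hve le_add_self |>.trans (by
        rw [add_comm (Finsupp.single a 1)])
    · refine ⟨(a, v), by simp [hvB], ?_⟩
      intro x
      have := hve x
      simp only [Finsupp.add_apply]
      omega
  · rintro ⟨⟨x, y⟩, hxy, hle⟩
    simp only [Finset.coe_union, Set.mem_union, Finset.mem_coe, Finset.mem_product,
      Finset.mem_singleton] at hxy
    rcases hxy with ⟨hx, hy⟩ | ⟨rfl, hy⟩
    · refine ⟨x, by simp [hx], ?_⟩
      have h1 := hle x
      have hxa : x ≠ a := by rintro rfl; exact haA hx
      rw [Finsupp.single_le_iff, hw1 x (hA hx)]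
      simpa [hxa, hne (hA hx) hy, hne (hA hx) hb] using h1
    · refine ⟨y, by simp [hy], ?_⟩
      have h1 := hle y
      have hyb : y ≠ b := by rintro rfl; exact hbB hy
      rw [Finsupp.single_le_iff]
      simpa [hyb, (hne ha (hB hy)).symm] using h1

lemma sum_add_card_le {T U : Finset V} (hw : ∀ v, 1 ≤ w v) (h : T ⊆ U) :
    ∑ v ∈ T, w v + U.card ≤ ∑ v ∈ U, w v + T.card := by
  rw [← Finset.sum_sdiff h, ← Finset.card_sdiff_add_card_eq_card h]
  have : (U \ T).card ≤ ∑ v ∈ U \ T, w v := by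
    rw [Finset.card_eq_sum_ones]
    exact Finset.sum_le_sum fun v _ => hw v
  omega

/-- The quotient by the edges `P` has a free resolution of length less than `|X| + |Y|` with the
degrees predicted by the regularity of the complete bipartite graph on `X` and `Y`. -/
def HasBoundedRes (k : Type) [Field k] (w : V → ℕ) (X Y : Finset V)
    (P : Finset (V × V)) : Prop :=
  ∃ H : GrRes (monIdeal k (edgeExps w (P : Set (V × V)))), ∀ i (x : H.ι (i + 1)),
    H.deg _ x + Y.card ≤ ∑ v ∈ Y, w v + 2 + i ∧ i + 2 ≤ X.card + Y.card

lemma HasBoundedRes.insert_edge (hw : ∀ v, 1 ≤ w v) (hw1 : ∀ x ∈ X, w x = 1) (hXY : Disjoint X Y)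
    (hA : A ⊆ X) (hB : B ⊆ Y) (ha : a ∈ X) (haA : a ∉ A) (hb : b ∈ Y) (hbB : b ∉ B)
    (h : HasBoundedRes k w X Y (A ×ˢ Y ∪ {a} ×ˢ B)) :
    ∃ H : GrRes (monIdeal k (edgeExps w
        ((A ×ˢ Y ∪ {a} ×ˢ (insert b B) : Finset (V × V)) : Set (V × V)))),
      (∀ i (x : H.ι (i + 1)),
        H.deg _ x + Y.card ≤ ∑ v ∈ Y, w v + 2 + i ∧ i + 2 ≤ X.card + Y.card) ∧
      ∃ x, H.deg (A.card + B.card + 1) x = A.card + ∑ v ∈ B, w v + 1 + w b := by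
  obtain ⟨G, hG⟩ := h
  obtain ⟨F, hF, z, hz⟩ := exists_grRes_powers (k := k) hw (A ∪ B)
  have hAB : Disjoint A B :=
    Finset.disjoint_of_subset_left hA (Finset.disjoint_of_subset_right hB hXY)
  have hA1 : ∑ v ∈ A, w v = A.card := by
    rw [Finset.card_eq_sum_ones]
    exact Finset.sum_congr rfl fun v hv => hw1 v (hA hv)
  rw [Finset.sum_union hAB, hA1] at hF hz
  rw [Finset.card_union_of_disjoint hAB] at hF
  have hcard : (A ∪ B).card = A.card + B.card := Finset.card_union_of_disjoint hAB
  obtain ⟨H, hH, hH'⟩ := exists_grRes_insert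
    (edgeExps_colon hw1 hXY hA hB ha haA hb hbB) F G
  have hins : insert (Finsupp.single a 1 + Finsupp.single b (w b))
      (edgeExps w ((A ×ˢ Y ∪ {a} ×ˢ B : Finset (V × V)) : Set (V × V))) =
      edgeExps w ((A ×ˢ Y ∪ {a} ×ˢ insert b B : Finset (V × V)) : Set (V × V)) := by
    refine (Set.image_insert_eq
      (f := fun p : V × V => Finsupp.single p.1 1 + Finsupp.single p.2 (w p.2))
      (a := (a, b))).symm.trans (congrArg _ ?_)
    ext ⟨x, y⟩
    simp
  rw [← hins]
  refine ⟨H, fun i x => ?_, ?_⟩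
  · rcases hH i x with ⟨c, hc⟩ | ⟨c, hc⟩
    · rw [hc]
      exact hG i c
    · obtain ⟨h1, h2⟩ := hF i c
      have hAX : A.card + 1 ≤ X.card := by
        rw [← Finset.card_insert_of_notMem haA]
        exact Finset.card_le_card (Finset.insert_subset ha hA)
      have hBY : B.card + 1 ≤ Y.card := by
        rw [← Finset.card_insert_of_notMem hbB]
        exact Finset.card_le_card (Finset.insert_subset hb hB)
      have h3 := sum_add_card_le hw (Finset.insert_subset hb hB)
      rw [Finset.sum_insert hbB, Finset.card_insert_of_notMem hbB] at h3
      rw [hc, map_add, Finsupp.degree_single, Finsupp.degree_single]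
      omega
  · obtain ⟨x, hx⟩ := hH' _ z
    rw [← hcard]
    refine ⟨x, ?_⟩
    rw [hx, hz, map_add, Finsupp.degree_single, Finsupp.degree_single]
    omega

lemma HasBoundedRes.union_star (hw : ∀ v, 1 ≤ w v) (hw1 : ∀ x ∈ X, w x = 1)
    (hXY : Disjoint X Y) (hA : A ⊆ X) (ha : a ∈ X) (haA : a ∉ A)
    (h : HasBoundedRes k w X Y (A ×ˢ Y)) (hB : B ⊆ Y) :
    HasBoundedRes k w X Y (A ×ˢ Y ∪ {a} ×ˢ B) := by
  induction B using Finset.induction_on with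
  | empty => simpa using h
  | insert b B hbB ih =>
    rw [Finset.insert_subset_iff] at hB
    obtain ⟨H, hH, -⟩ := (ih hB.2).insert_edge hw hw1 hXY hA hB.2 ha haA hB.1 hbB
    exact ⟨H, hH⟩

lemma hasBoundedRes_product (hw : ∀ v, 1 ≤ w v) (hw1 : ∀ x ∈ X, w x = 1)
    (hXY : Disjoint X Y) (hA : A ⊆ X) : HasBoundedRes k w X Y (A ×ˢ Y) := by
  induction A using Finset.induction_on with
  | empty =>
    obtain ⟨H, hH, -⟩ := exists_grRes_empty (k := k) (V := V)
    rw [HasBoundedRes, Finset.empty_product, Finset.coe_empty, edgeExps, Set.image_empty]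
    exact ⟨H, fun i x => (hH i).elim x⟩
  | insert a A haA ih =>
    rw [Finset.insert_subset_iff] at hA
    have h := (ih hA.2).union_star hw hw1 hXY hA.2 hA.1 haA subset_rfl
    rwa [← Finset.union_product, Finset.union_comm, ← Finset.insert_eq] at h

/-- The edge ideal of the complete bipartite graph on `X` and `Y` has a free resolution with a
basis element that attains the extremal degree in the last step. -/
lemma exists_grRes_completeBipartite (hw : ∀ v, 1 ≤ w v) (hw1 : ∀ x ∈ X, w x = 1)
    (hXY : Disjoint X Y) (hX : X.Nonempty) (hY : Y.Nonempty) :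
    ∃ H : GrRes (monIdeal k (edgeExps w ((X ×ˢ Y : Finset (V × V)) : Set (V × V)))),
      (∀ i (x : H.ι (i + 1)),
        H.deg _ x + Y.card ≤ ∑ v ∈ Y, w v + 2 + i ∧ i + 2 ≤ X.card + Y.card) ∧
      ∃ n x, n + 2 = X.card + Y.card ∧ H.deg (n + 1) x + Y.card = ∑ v ∈ Y, w v + 2 + n := by
  obtain ⟨a, ha⟩ := hX
  obtain ⟨b, hb⟩ := hY
  have haA := Finset.notMem_erase a X
  have hbB := Finset.notMem_erase b Y
  have hA := Finset.erase_subset a X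
  have hB := Finset.erase_subset b Y
  obtain ⟨H, hH, x, hx⟩ := ((hasBoundedRes_product (k := k) hw hw1 hXY hA).union_star
    hw hw1 hXY hA ha haA hB).insert_edge hw hw1 hXY hA hB ha haA hb hbB
  have hP : (X.erase a) ×ˢ Y ∪ {a} ×ˢ insert b (Y.erase b) = X ×ˢ Y := by
    rw [Finset.insert_erase hb, ← Finset.union_product, Finset.union_comm, ← Finset.insert_eq,
      Finset.insert_erase ha]
  rw [← hP]
  refine ⟨H, hH, _, x, ?_, ?_⟩
  · have := Finset.card_erase_add_one ha
    have := Finset.card_erase_add_one hb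
    omega
  · have := Finset.card_erase_add_one hb
    have := Finset.sum_erase_add Y w hb
    omega

end Bipartite

section MinFreeRes

variable {I : Ideal (MvPolynomial V k)}

/-- The basis of the resolution of the quotient by `I` given by a resolution of `I`. -/
def MinFreeRes.augIndex (R : MinFreeRes I) : ℕ → Type
  | 0 => Unit
  | i + 1 => R.ι i

/-- The degrees of the basis `MinFreeRes.augIndex`. -/
def MinFreeRes.augDeg (R : MinFreeRes I) : ∀ i, R.augIndex i → ℕ
  | 0 => fun _ => 0
  | i + 1 => R.deg i

/-- The differential of the resolution of the quotient by `I` given by a resolution of `I`. -/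
def MinFreeRes.augD (R : MinFreeRes I) : ∀ i, (R.augIndex (i + 1) →₀ MvPolynomial V k)
    →ₗ[MvPolynomial V k] (R.augIndex i →₀ MvPolynomial V k)
  | 0 => Finsupp.lsingle () ∘ₗ R.aug
  | i + 1 => R.d i

/-- A minimal free resolution of `I` as a resolution of the quotient by `I`. -/
def MinFreeRes.toGrRes (R : MinFreeRes I) : GrRes I where
  ι := R.augIndex
  deg := R.augDeg
  d := R.augD
  graded := by
    rintro (_ | i) a b m hm
    · have h := R.aug_homog a
      have hm' : coeff m (Finsupp.single () (R.aug (Finsupp.single a 1)) ()) ≠ 0 := hm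
      rw [Finsupp.single_eq_same] at hm'
      have h1 : m.degree = R.deg 0 a := by
        rw [Finsupp.degree_eq_weight_one]
        exact h hm'
      exact h1
    · have hm' : coeff m (R.d i (Finsupp.single a 1) b) ≠ 0 := hm
      rcases R.d_homog i a b with h | ⟨e, he, h⟩
      · simp [h] at hm'
      · have h1 : m.degree = e := by
          rw [Finsupp.degree_eq_weight_one]
          exact h hm'
        change m.degree + R.deg i b = R.deg (i + 1) a
        omega
  root := inferInstanceAs (Unique Unit)
  deg_root := rfl
  exact := by
    rintro (_ | i) u
    · have h : ∀ u : R.ι 0 →₀ MvPolynomial V k,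
          Finsupp.single () (R.aug u) = 0 ↔ ∃ v, R.d 0 v = u := by
        intro u
        rw [Finsupp.single_eq_zero, ← LinearMap.mem_ker, ← R.exact_zero, LinearMap.mem_range]
      exact h u
    · have h : ∀ u : R.ι (i + 1) →₀ MvPolynomial V k,
          R.d i u = 0 ↔ ∃ v, R.d (i + 1) v = u := by
        intro u
        rw [← LinearMap.mem_ker, ← R.exact_succ, LinearMap.mem_range]
      exact h u
  range_zero := by
    have h : ∀ u : Unit →₀ MvPolynomial V k,
        (∃ v, Finsupp.single () (R.aug v) = u) ↔ u () ∈ I := by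
      intro u
      have hu : u () ∈ I ↔ ∃ v, R.aug v = u () := by rw [← LinearMap.mem_range, R.aug_range]
      rw [hu]
      constructor
      · rintro ⟨v, rfl⟩
        exact ⟨v, by simp⟩
      · rintro ⟨v, hv⟩
        exact ⟨v, by ext; simp [hv]⟩
    exact h

lemma constantCoeff_eq_zero_of_mem_mIdeal {p : MvPolynomial V k} (hp : p ∈ mIdeal k V) :
    constantCoeff p = 0 := by
  have : mIdeal k V ≤ RingHom.ker (constantCoeff (σ := V) (R := k)) := by
    rw [mIdeal, Ideal.span_le]
    rintro _ ⟨v, rfl⟩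
    simp
  exact this hp

lemma mem_regSet_iff (R : MinFreeRes I) (t : ℤ) :
    t ∈ R.regSet ↔ ∃ i a, t = (R.deg i a : ℤ) - i := by
  constructor
  · rintro ⟨i, j, h, rfl⟩
    rw [MinFreeRes.betti] at h
    obtain ⟨⟨a, rfl⟩⟩ := (Nat.card_ne_zero.1 h).1
    exact ⟨i, a, rfl⟩
  · rintro ⟨i, a, rfl⟩
    have := R.finite i
    exact ⟨i, R.deg i a, Nat.card_ne_zero.2 ⟨⟨⟨a, rfl⟩⟩, inferInstance⟩, rfl⟩

lemma MinFreeRes.constantCoeff_augD (R : MinFreeRes I) (hI : I ≤ mIdeal k V) (i : ℕ)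
    (a : R.augIndex (i + 1)) (b : R.augIndex i) :
    constantCoeff (R.augD i (Finsupp.single a 1) b) = 0 := by
  cases i with
  | zero =>
    have h : ∀ a : R.ι 0,
        constantCoeff (Finsupp.single () (R.aug (Finsupp.single a 1)) ()) = 0 := by
      intro a
      rw [Finsupp.single_eq_same]
      refine constantCoeff_eq_zero_of_mem_mIdeal (hI ?_)
      have := LinearMap.mem_range_self R.aug (Finsupp.single a 1)
      rwa [R.aug_range] at this
    exact h a
  | succ i => exact constantCoeff_eq_zero_of_mem_mIdeal (R.minimal i a b)

lemma MinFreeRes.exists_deg_eq (R : MinFreeRes I) (hI : I ≤ mIdeal k V) (H : GrRes I) (i : ℕ)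
    (a : R.ι i) : ∃ b, H.deg (i + 1) b = R.deg i a :=
  R.toGrRes.exists_deg_eq H i a (fun c => R.constantCoeff_augD hI (i + 1) c a)
    fun c => R.constantCoeff_augD hI i a c

lemma edgeIdeal_le_mIdeal (E : Set (V × V)) (w : V → ℕ) : edgeIdeal k E w ≤ mIdeal k V := by
  rw [edgeIdeal, Ideal.span_le]
  rintro _ ⟨e, -, rfl⟩
  exact Ideal.mul_mem_right _ _ (Ideal.subset_span ⟨e.1, rfl⟩)

end MinFreeRes

end WOG

/-- **Lemma (complete bipartite, regularity).**
`D` is a vertex-weighted oriented complete bipartite graph: the vertex set is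
partitioned into nonempty parts `V_1, V_2` (encoded by `part : V → Fin 2`),
the edges are exactly all pairs `(x, y)` with `x ∈ V_1`, `y ∈ V_2`, and the
sources (the vertices of `V_1`) have weight `1`.
Then `reg I(D) = (∑_{x ∈ V} w(x)) - |V| + 2`. -/
theorem complete_bipartite_reg (k : Type) [Field k]
    (V : Type) [Fintype V] (part : V → Fin 2) (hpart : ∀ i : Fin 2, ∃ x : V, part x = i)
    (E : Set (V × V))
    (hE : E = {p : V × V | (part p.1 : ℕ) = 0 ∧ (part p.2 : ℕ) = 1})
    (w : V → ℕ) (hw : ∀ x : V, 1 ≤ w x)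
    (hw1 : ∀ x : V, (part x : ℕ) = 0 → w x = 1)
    (R : WOG.MinFreeRes (WOG.edgeIdeal k E w)) :
    IsGreatest R.regSet ((∑ x : V, (w x : ℤ)) - (Fintype.card V : ℤ) + 2) := by
  classical
  set X := Finset.univ.filter fun v => (part v : ℕ) = 0
  set Y := Finset.univ.filter fun v => (part v : ℕ) = 1
  have hXY : Disjoint X Y := by
    rw [Finset.disjoint_filter]
    intro v _ h0 h1
    omega
  have hX : X.Nonempty := by
    obtain ⟨x, hx⟩ := hpart 0
    exact ⟨x, by simp [X, hx]⟩
  have hY : Y.Nonempty := by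
    obtain ⟨y, hy⟩ := hpart 1
    exact ⟨y, by simp [Y, hy]⟩
  have huniv : X ∪ Y = Finset.univ := by
    ext v
    simp only [X, Y, Finset.mem_union, Finset.mem_filter, Finset.mem_univ, true_and, iff_true]
    omega
  have hwX : ∀ x ∈ X, w x = 1 := fun x hx => hw1 x (Finset.mem_filter.1 hx).2
  have hEXY : E = ((X ×ˢ Y : Finset (V × V)) : Set (V × V)) := by
    rw [hE]
    ext p
    simp [X, Y]
  have hcard : Fintype.card V = X.card + Y.card := by
    rw [← Finset.card_univ, ← huniv, Finset.card_union_of_disjoint hXY]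
  have hsum : ∑ v, (w v : ℤ) = X.card + ((∑ v ∈ Y, w v : ℕ) : ℤ) := by
    rw [← huniv, Finset.sum_union hXY, Finset.card_eq_sum_ones, Nat.cast_sum, Nat.cast_sum]
    congr 1
    exact Finset.sum_congr rfl fun x hx => by rw [hwX x hx]
  have hres := WOG.exists_grRes_completeBipartite (k := k) hw hwX hXY hX hY
  rw [← hEXY, ← WOG.edgeIdeal_eq_monIdeal] at hres
  obtain ⟨H, hH, n, x, hn, hx⟩ := hres
  have hYsum : Y.card ≤ ∑ v ∈ Y, w v := by
    rw [Finset.card_eq_sum_ones]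
    exact Finset.sum_le_sum fun v _ => hw v
  have hmin : ∀ c, constantCoeff (H.d n (Finsupp.single x 1) c) = 0 := by
    intro c
    by_contra hc
    have hdeg := H.graded n x c 0 hc
    rw [map_zero, zero_add] at hdeg
    cases n with
    | zero =>
      have hroot : H.deg 0 c = 0 := by
        rw [H.root.uniq c]
        exact H.deg_root
      omega
    | succ n =>
      have := (hH n c).1
      omega
  obtain ⟨a, ha⟩ := H.exists_deg_eq R.toGrRes n x
    (fun c => absurd (hH (n + 1) c).2 (by omega)) hmin
  constructor
  · refine (WOG.mem_regSet_iff R _).2 ⟨n, a, ?_⟩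
    have ha' : R.deg n a = H.deg (n + 1) x := ha
    rw [hsum, hcard]
    omega
  · intro t ht
    obtain ⟨i, a, rfl⟩ := (WOG.mem_regSet_iff R t).1 ht
    obtain ⟨b, hb⟩ := R.exists_deg_eq (WOG.edgeIdeal_le_mIdeal E w) H i a
    have := (hH i b).1
    rw [hsum, hcard]
    omega
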